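/- Every finitely generated Abelian subgroup of Homeo₊(I) has finite strict height. -/

import Mathlib

open Set

namespace HeightHomeo

/-- The group of orientation-preserving homeomorphisms of a linearly ordered space,
modeled as order-automorphisms (for `I = [0,1]` these are exactly the
orientation-preserving homeomorphisms). -/
instance ordIsoGroup {α : Type*} [Preorder α] : Group (α ≃o α) where
  mul f g := g.trans f
  one := OrderIso.refl α
  inv := OrderIso.symm
  mul_assoc _ _ _ := rfl
  one_mul _ := rfl
  mul_one _ := rfl
  inv_mul_cancel f := by ext x; exact f.symm_apply_apply x

/-- `Homeo₊(I)`: the group of orientation-preserving homeomorphisms of the closed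
unit interval `I = [0,1]`. -/
abbrev HomeoI := unitInterval ≃o unitInterval

/-- The order-convex hull of a set of points of the unit interval. -/
def ordHull (S : Set unitInterval) : Set unitInterval :=
  {y | ∃ a ∈ S, ∃ b ∈ S, a ≤ y ∧ y ≤ b}

/-- `A` is an orbital of the homeomorphism `g`: the convex hull of the orbit of some
point of `I` under the cyclic subgroup `⟨g⟩`, provided it contains more than one point. -/
def IsOrbitalOf (g : HomeoI) (A : Set unitInterval) : Prop :=
  ∃ x : unitInterval,
    A = ordHull (Set.range fun n : ℤ => (g ^ n) x) ∧ A.Nontrivial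

/-- A tower of a subgroup `Γ ≤ Homeo₊(I)`: a set `T` of signed orbitals `(A, g)`
(with `g ∈ Γ` and `A` an orbital of `g`) whose orbitals form a chain under inclusion,
and containing exactly one signed orbital for each of the occurring orbitals. -/
def IsTower (Γ : Subgroup HomeoI) (T : Set (Set unitInterval × HomeoI)) : Prop :=
  (∀ p ∈ T, p.2 ∈ Γ ∧ IsOrbitalOf p.2 p.1) ∧
  (∀ p ∈ T, ∀ q ∈ T, p.1 ⊆ q.1 ∨ q.1 ⊆ p.1) ∧
  (∀ p ∈ T, ∀ q ∈ T, p.1 = q.1 → p = q)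

/-- The left endpoint of a set of points of the unit interval, as a real number. -/
noncomputable def leftEnd (A : Set unitInterval) : ℝ :=
  sInf ((fun x : unitInterval => (x : ℝ)) '' A)

/-- The right endpoint of a set of points of the unit interval, as a real number. -/
noncomputable def rightEnd (A : Set unitInterval) : ℝ :=
  sSup ((fun x : unitInterval => (x : ℝ)) '' A)

/-- Two intervals share an end if they have a common left endpoint or a common right
endpoint. -/
def ShareEnd (A B : Set unitInterval) : Prop :=
  leftEnd A = leftEnd B ∨ rightEnd A = rightEnd B

/-- A tower is strict if no two distinct orbitals occurring in it share an end. -/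
def IsStrictTower (Γ : Subgroup HomeoI) (T : Set (Set unitInterval × HomeoI)) : Prop :=
  IsTower Γ T ∧ ∀ p ∈ T, ∀ q ∈ T, p.1 ≠ q.1 → ¬ ShareEnd p.1 q.1

/-- The set of orbitals occurring in a tower. -/
def towerOrbitals (T : Set (Set unitInterval × HomeoI)) : Set (Set unitInterval) :=
  Prod.fst '' T

/-- The height `h(Γ)` of a subgroup of `Homeo₊(I)`: the supremum (in `ℕ∞`) of the
cardinalities of the sets of orbitals of its towers. -/
noncomputable def height (Γ : Subgroup HomeoI) : ℕ∞ :=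
  ⨆ T ∈ {T | IsTower Γ T}, (towerOrbitals T).encard

/-- The strict height `h_strict(Γ)` of a subgroup of `Homeo₊(I)`: the supremum (in
`ℕ∞`) of the cardinalities of the sets of orbitals of its strict towers. -/
noncomputable def strictHeight (Γ : Subgroup HomeoI) : ℕ∞ :=
  ⨆ T ∈ {T | IsStrictTower Γ T}, (towerOrbitals T).encard

section Orbitals

variable {f g : HomeoI} {A : Set unitInterval} {x y z : unitInterval}

theorem mul_apply (f g : HomeoI) (x : unitInterval) : (f * g) x = f (g x) := rfl

theorem one_apply (x : unitInterval) : (1 : HomeoI) x = x := rfl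

theorem zpow_add_apply (g : HomeoI) (m n : ℤ) (x : unitInterval) :
    (g ^ (m + n)) x = (g ^ m) ((g ^ n) x) := by
  rw [zpow_add, mul_apply]

/-- The subgroup of homeomorphisms fixing a point. -/
def pointStabilizer (x : unitInterval) : Subgroup HomeoI where
  carrier := {g | g x = x}
  one_mem' := rfl
  mul_mem' {f g} hf hg := by
    change f (g x) = x
    rw [show g x = x from hg, show f x = x from hf]
  inv_mem' {g} hg := by
    change g.symm x = x
    rw [OrderIso.symm_apply_eq]
    exact (show g x = x from hg).symm

theorem mem_pointStabilizer : g ∈ pointStabilizer x ↔ g x = x := Iff.rfl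

theorem pow_apply_eq_iterate (g : HomeoI) (n : ℕ) (x : unitInterval) :
    (g ^ n) x = g^[n] x := by
  induction n with
  | zero => rfl
  | succ n ih => rw [pow_succ', mul_apply, ih, Function.iterate_succ_apply']

theorem apply_eq_of_zpow_apply_eq {k : ℤ} (hk : k ≠ 0) (h : (g ^ k) x = x) : g x = x := by
  have hpow : g ^ k.natAbs ∈ pointStabilizer x := by
    have hmem : g ^ k ∈ pointStabilizer x := h
    rcases Int.natAbs_eq k with hk' | hk'
    · rwa [hk', zpow_natCast] at hmem
    · rwa [hk', zpow_neg, zpow_natCast, inv_mem_iff] at hmem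
  rw [mem_pointStabilizer, pow_apply_eq_iterate] at hpow
  have hcomm : Function.Commute (g : unitInterval → unitInterval) id :=
    Function.Commute.id_right
  exact (hcomm.iterate_pos_eq_iff_map_eq g.monotone strictMono_id
    (Int.natAbs_pos.mpr hk)).mp (by simpa using hpow)

/-- The convex hull of the orbit of `x` under `⟨g⟩`. -/
def orbitHull (g : HomeoI) (x : unitInterval) : Set unitInterval :=
  ordHull (Set.range fun n : ℤ => (g ^ n) x)

theorem mem_orbitHull :
    y ∈ orbitHull g x ↔ ∃ m n : ℤ, (g ^ m) x ≤ y ∧ y ≤ (g ^ n) x := by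
  simp [orbitHull, ordHull]

theorem self_mem_orbitHull (g : HomeoI) (x : unitInterval) : x ∈ orbitHull g x :=
  mem_orbitHull.mpr ⟨0, 0, le_rfl, le_rfl⟩

theorem zpow_apply_le_iff (m : ℤ) : (g ^ m) x ≤ y ↔ x ≤ (g ^ (-m)) y := by
  rw [← (g ^ (-m)).le_iff_le, ← zpow_add_apply, neg_add_cancel, zpow_zero, one_apply]

theorem le_zpow_apply_iff (m : ℤ) : y ≤ (g ^ m) x ↔ (g ^ (-m)) y ≤ x := by
  rw [zpow_apply_le_iff, neg_neg]

theorem mem_orbitHull_symm (h : y ∈ orbitHull g x) : x ∈ orbitHull g y := by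
  obtain ⟨m, n, hm, hn⟩ := mem_orbitHull.mp h
  exact mem_orbitHull.mpr ⟨-n, -m, (le_zpow_apply_iff n).mp hn, (zpow_apply_le_iff m).mp hm⟩

theorem orbitHull_subset (h : y ∈ orbitHull g x) : orbitHull g y ⊆ orbitHull g x := by
  intro w hw
  obtain ⟨m, n, hm, hn⟩ := mem_orbitHull.mp h
  obtain ⟨a, b, ha, hb⟩ := mem_orbitHull.mp hw
  refine mem_orbitHull.mpr ⟨a + m, b + n, ?_, ?_⟩
  · rw [zpow_add_apply]
    exact ((g ^ a).monotone hm).trans ha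
  · rw [zpow_add_apply]
    exact hb.trans ((g ^ b).monotone hn)

theorem orbitHull_eq (h : y ∈ orbitHull g x) : orbitHull g y = orbitHull g x :=
  (orbitHull_subset h).antisymm (orbitHull_subset (mem_orbitHull_symm h))

theorem image_orbitHull (h : Commute f g) (x : unitInterval) :
    f '' orbitHull g x = orbitHull g (f x) := by
  have hcomm (n : ℤ) : (g ^ n) (f x) = f ((g ^ n) x) := by
    rw [← mul_apply, ← mul_apply, (h.zpow_right n).eq]
  ext w
  obtain ⟨y, rfl⟩ := f.surjective w
  rw [f.injective.mem_set_image]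
  simp [mem_orbitHull, hcomm]

theorem IsOrbitalOf.eq_orbitHull (hA : IsOrbitalOf g A) (hy : y ∈ A) : A = orbitHull g y := by
  obtain ⟨x, rfl, -⟩ := hA
  exact (orbitHull_eq hy).symm

theorem IsOrbitalOf.nonempty (hA : IsOrbitalOf g A) : A.Nonempty := by
  obtain ⟨x, -, hA⟩ := hA
  exact hA.nonempty

theorem IsOrbitalOf.ordConnected (hA : IsOrbitalOf g A) : A.OrdConnected := by
  obtain ⟨x, rfl, -⟩ := hA
  refine ⟨fun a ⟨b, hb, c, hc, hba, hac⟩ a' ⟨b', hb', c', hc', hba', hac'⟩ w hw => ?_⟩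
  exact ⟨b, hb, c', hc', hba.trans hw.1, hw.2.trans hac'⟩

theorem IsOrbitalOf.apply_mem (hA : IsOrbitalOf g A) (hy : y ∈ A) : g y ∈ A := by
  rw [hA.eq_orbitHull hy]
  exact mem_orbitHull.mpr ⟨1, 1, (by rw [zpow_one]), (by rw [zpow_one])⟩

/-- A homeomorphism has no periodic points in its orbitals. -/
theorem IsOrbitalOf.zpow_apply_ne (hA : IsOrbitalOf g A) (hy : y ∈ A) {k : ℤ} (hk : k ≠ 0) :
    (g ^ k) y ≠ y := by
  intro h
  have hfix (n : ℤ) : (g ^ n) y = y :=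
    zpow_mem (mem_pointStabilizer.mpr (apply_eq_of_zpow_apply_eq hk h)) n
  have hA' := hA.eq_orbitHull hy
  obtain ⟨x, -, hnt⟩ := hA
  obtain ⟨a, ha, b, hb, hab⟩ := hnt
  have heq : ∀ w ∈ A, w = y := by
    intro w hw
    rw [hA', mem_orbitHull] at hw
    obtain ⟨m, n, hm, hn⟩ := hw
    rw [hfix] at hm hn
    exact le_antisymm hn hm
  exact hab ((heq a ha).trans (heq b hb).symm)

/-- A homeomorphism commuting with `g` that sends some point of an orbital of `g` into that
orbital preserves the orbital. -/
theorem IsOrbitalOf.image_eq (hA : IsOrbitalOf g A) (h : Commute f g) (hy : y ∈ A)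
    (hfy : f y ∈ A) : f '' A = A := by
  conv_lhs => rw [hA.eq_orbitHull hy]
  rw [image_orbitHull h, ← hA.eq_orbitHull hfy]

theorem apply_eq_of_isLUB (hz : IsLUB A z) (hf : f '' A = A) : f z = z := by
  have hfz : IsLUB (f '' A) (f z) := f.isLUB_image'.mpr hz
  rw [hf] at hfz
  exact hfz.unique hz

theorem isLUB_iff_rightEnd (hA : A.Nonempty) : IsLUB A z ↔ (z : ℝ) = rightEnd A := by
  have hne : ((fun x : unitInterval => (x : ℝ)) '' A).Nonempty := hA.image _
  have hbdd : BddAbove ((fun x : unitInterval => (x : ℝ)) '' A) :=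
    ⟨1, by rintro _ ⟨x, -, rfl⟩; exact x.2.2⟩
  have hsup := isLUB_csSup hne hbdd
  obtain ⟨a, ha⟩ := hA
  have hmem : rightEnd A ∈ unitInterval := by
    refine ⟨a.2.1.trans (hsup.1 ⟨a, ha, rfl⟩), hsup.2 ?_⟩
    rintro _ ⟨x, -, rfl⟩
    exact x.2.2
  have hlub : IsLUB A (⟨rightEnd A, hmem⟩ : unitInterval) := by
    refine ⟨fun x hx => hsup.1 ⟨x, hx, rfl⟩, fun b hb => hsup.2 ?_⟩
    rintro _ ⟨x, hx, rfl⟩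
    exact hb hx
  constructor
  · intro h
    rw [h.unique hlub]
  · intro h
    rwa [show z = ⟨rightEnd A, hmem⟩ from Subtype.ext h]

theorem rightEnd_mono {B : Set unitInterval} (hA : A.Nonempty) (hAB : A ⊆ B) :
    rightEnd A ≤ rightEnd B :=
  csSup_le_csSup ⟨1, by rintro _ ⟨x, -, rfl⟩; exact x.2.2⟩ (hA.image _) (image_mono hAB)

/-- A convex set contains the supremum of any of its nonempty subsets with a smaller right
endpoint. -/
theorem mem_of_rightEnd_lt {B : Set unitInterval} (hB : B.OrdConnected) (hA : A.Nonempty)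
    (hAB : A ⊆ B) (hz : IsLUB A z) (hlt : rightEnd A < rightEnd B) : z ∈ B := by
  rw [← (isLUB_iff_rightEnd hA).mp hz] at hlt
  obtain ⟨_, ⟨w, hw, rfl⟩, hzw⟩ := exists_lt_of_lt_csSup ((hA.mono hAB).image _) hlt
  obtain ⟨a, ha⟩ := hA
  exact hB.out (hAB ha) hw ⟨hz.1 ha, le_of_lt hzw⟩

end Orbitals

/-- A family indexed by heights is independent over `ℤ` if each member lies in the subgroups
attached to all indices at least as high, while its nonzero multiples avoid those attached to
lower indices. -/
theorem linearIndependent_int_of_addSubgroups {ι M R : Type*} [LinearOrder R] [AddCommGroup M]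
    (v : ι → M) (S : ι → AddSubgroup M) (r : ι → R) (hr : Function.Injective r)
    (hmem : ∀ i j, r i ≤ r j → v i ∈ S j)
    (hnmem : ∀ i j, r i < r j → ∀ c : ℤ, c ≠ 0 → c • v j ∉ S i)
    (hzero : ∀ i, ∀ c : ℤ, c ≠ 0 → c • v i ≠ 0) :
    LinearIndependent ℤ v := by
  classical
  rw [linearIndependent_iff']
  intro s c hsum
  by_contra! hc
  have ht : (s.filter fun i => c i ≠ 0).Nonempty := by
    obtain ⟨i, hi, hci⟩ := hc
    exact ⟨i, by simp [hi, hci]⟩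
  have hsum' : ∑ i ∈ s.filter (fun i => c i ≠ 0), c i • v i = 0 := by
    rw [Finset.sum_filter_of_ne, hsum]
    rintro i - hi h
    exact hi (by rw [h, zero_smul])
  obtain ⟨p, hp, hpmax⟩ := Finset.exists_max_image _ r ht
  have hcp : c p ≠ 0 := (Finset.mem_filter.mp hp).2
  rw [← Finset.add_sum_erase _ _ hp] at hsum'
  rcases ((s.filter fun i => c i ≠ 0).erase p).eq_empty_or_nonempty with he | he
  · rw [he, Finset.sum_empty, add_zero] at hsum'
    exact hzero p _ hcp hsum'
  · obtain ⟨q, hq, hqmax⟩ := Finset.exists_max_image _ r he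
    obtain ⟨hqp, hq'⟩ := Finset.mem_erase.mp hq
    refine hnmem q p ((hpmax q hq').lt_of_ne (hr.ne hqp)) _ hcp ?_
    rw [eq_neg_of_add_eq_zero_left hsum']
    exact neg_mem (sum_mem fun i hi => zsmul_mem (hmem i q (hqmax i hi)) _)

/-- The strict towers of a finitely generated abelian group have at most as many elements as
its rank. -/
theorem exists_encard_le_of_isStrictTower {Γ : Subgroup HomeoI} [Group.FG Γ]
    (hab : ∀ a ∈ Γ, ∀ b ∈ Γ, a * b = b * a) :
    ∃ n : ℕ, ∀ T, IsStrictTower Γ T → T.encard ≤ n := by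
  let _ : CommGroup Γ :=
    { (inferInstance : Group Γ) with
      mul_comm := fun a b => Subtype.ext (hab a a.2 b b.2) }
  have : Module.Finite ℤ (Additive Γ) :=
    Module.Finite.iff_addGroup_fg.mpr inferInstance
  refine ⟨Module.finrank ℤ (Additive Γ), fun T hT => ?_⟩
  obtain ⟨⟨horb, hchain, huniq⟩, hstrict⟩ := hT
  have hne (p : T) : p.1.1.Nonempty := (horb p p.2).2.nonempty
  choose z hz using fun p : T => (⟨sSup p.1.1, isLUB_sSup _⟩ : ∃ z, IsLUB p.1.1 z)
  have hinj : Function.Injective fun p : T => rightEnd p.1.1 := by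
    intro p q hpq
    by_contra hne
    refine hstrict p p.2 q q.2 (fun h => hne (Subtype.ext (huniq p p.2 q q.2 h))) (Or.inr hpq)
  have hsub (p q : T) (h : rightEnd p.1.1 ≤ rightEnd q.1.1) : p.1.1 ⊆ q.1.1 := by
    rcases hchain p p.2 q q.2 with h' | h'
    · exact h'
    · rw [hinj (h.antisymm (rightEnd_mono (hne q) h'))]
  let v : T → Additive Γ := fun p => Additive.ofMul ⟨p.1.2, (horb p p.2).1⟩
  have hv : LinearIndependent ℤ v := by
    refine linearIndependent_int_of_addSubgroups v
      (fun p => Subgroup.toAddSubgroup ((pointStabilizer (z p)).subgroupOf Γ))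
      (fun p => rightEnd p.1.1) hinj ?_ ?_ ?_
    · intro p q hpq
      change p.1.2 (z q) = z q
      obtain ⟨y, hy⟩ := hne p
      have hcomm : Commute p.1.2 q.1.2 := hab _ (horb p p.2).1 _ (horb q q.2).1
      exact apply_eq_of_isLUB (hz q) ((horb q q.2).2.image_eq hcomm (hsub p q hpq hy)
        (hsub p q hpq ((horb p p.2).2.apply_mem hy)))
    · intro p q hpq c hc
      change ¬ (q.1.2 ^ c) (z p) = z p
      exact (horb q q.2).2.zpow_apply_ne (mem_of_rightEnd_lt (horb q q.2).2.ordConnected (hne p)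
        (hsub p q hpq.le) (hz p) hpq) hc
    · intro p c hc h
      obtain ⟨y, hy⟩ := hne p
      have h' : p.1.2 ^ c = 1 := congrArg Subtype.val (congrArg Additive.toMul h)
      exact (horb p p.2).2.zpow_apply_ne hy hc (by rw [h', one_apply])
  have : Finite T := hv.finite
  have : Fintype T := Fintype.ofFinite T
  rw [← Set.coe_fintypeCard]
  exact_mod_cast hv.fintype_card_le_finrank

/-- Every finitely generated Abelian subgroup of `Homeo₊(I)` has finite strict
height. -/
theorem fg_abelian_finite_strictHeight (Γ : Subgroup HomeoI)
    (hfg : Γ.FG)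
    (hab : ∀ a ∈ Γ, ∀ b ∈ Γ, a * b = b * a) :
    strictHeight Γ < ⊤ := by
  have : Group.FG Γ := (Group.fg_iff_subgroup_fg Γ).mpr hfg
  obtain ⟨n, hn⟩ := exists_encard_le_of_isStrictTower hab
  refine lt_of_le_of_lt (iSup₂_le fun T hT => ?_) (ENat.natCast_lt_top n)
  exact (Set.encard_image_le _ _).trans (hn T hT)

end HeightHomeo
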